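/- Let A and B be block matrices over a field 𝔽 with the same block structure (n block rows/columns, block sizes N), admitting SSS representations with dimensions (r^h_{A,i}, r^g_{A,i}) and (r^h_{B,i}, r^g_{B,i}) respectively. Then C = AB admits an SSS representation whose dimensions satisfy r^h_{C,i} ≤ r^h_{A,i} + r^h_{B,i} and r^g_{C,i} ≤ r^g_{A,i} + r^g_{B,i} for all 1 ≤ i ≤ n−1. -/

import Mathlib

open Matrix

variable {𝔽 : Type*} [Field 𝔽]

/-- The product of `d` consecutive transition matrices `W k * W (k+1) * ⋯ * W (k+d-1)`. -/
def sssChainAux (rg : ℕ → ℕ) (W : ∀ j, Matrix (Fin (rg j)) (Fin (rg (j + 1))) 𝔽) (k : ℕ) :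
    (d : ℕ) → Matrix (Fin (rg k)) (Fin (rg (k + d))) 𝔽
  | 0 => (1 : Matrix (Fin (rg k)) (Fin (rg k)) 𝔽)
  | d + 1 => sssChainAux rg W k d * W (k + d)

/-- The product of the transition matrices `W k * W (k+1) * ⋯ * W (ℓ-1)` (the identity when
`k = ℓ`, and junk `0` when `ℓ < k`). -/
def sssChain (rg : ℕ → ℕ) (W : ∀ j, Matrix (Fin (rg j)) (Fin (rg (j + 1))) 𝔽) (k ℓ : ℕ) :
    Matrix (Fin (rg k)) (Fin (rg ℓ)) 𝔽 :=
  if h : k ≤ ℓ then Nat.add_sub_cancel' h ▸ sssChainAux rg W k (ℓ - k) else 0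

/-- A sequentially semi-separable (SSS) representation of a block matrix `A` (with `n` block
rows/columns, block `k` of size `N k`, blocks indexed from `0`) with dimensions `rg`, `rh`
(`rg c`, `rh c` being the state dimensions at the cut between blocks `c` and `c + 1`, for
`0 ≤ c ≤ n - 2`): the diagonal blocks of `A` are `D k`; the strictly upper blocks are
`A_{k ℓ} = U k * W k * W (k+1) * ⋯ * W (ℓ - 2) * (V ℓ)ᵀ` for `k < ℓ`; and the strictly lower
blocks are `A_{k ℓ} = P k * R (k-2) * R (k-3) * ⋯ * R ℓ * (Q ℓ)ᵀ` for `ℓ < k`. -/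
def IsSSSRep {n : ℕ} (N : ℕ → ℕ)
    (A : Matrix ((k : Fin n) × Fin (N k)) ((k : Fin n) × Fin (N k)) 𝔽)
    (rg rh : ℕ → ℕ)
    (U : ∀ k, Matrix (Fin (N k)) (Fin (rg k)) 𝔽)
    (W : ∀ j, Matrix (Fin (rg j)) (Fin (rg (j + 1))) 𝔽)
    (V : ∀ k, Matrix (Fin (N k)) (Fin (rg (k - 1))) 𝔽)
    (D : ∀ k, Matrix (Fin (N k)) (Fin (N k)) 𝔽)
    (P : ∀ k, Matrix (Fin (N k)) (Fin (rh (k - 1))) 𝔽)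
    (R : ∀ j, Matrix (Fin (rh (j + 1))) (Fin (rh j)) 𝔽)
    (Q : ∀ k, Matrix (Fin (N k)) (Fin (rh k)) 𝔽) : Prop :=
  (∀ (k : Fin n) (i j : Fin (N k)), A ⟨k, i⟩ ⟨k, j⟩ = D k i j) ∧
  (∀ (k ℓ : Fin n), (k : ℕ) < (ℓ : ℕ) → ∀ (i : Fin (N k)) (j : Fin (N ℓ)),
      A ⟨k, i⟩ ⟨ℓ, j⟩ = (U k * sssChain rg W k ((ℓ : ℕ) - 1) * (V ℓ)ᵀ) i j) ∧
  (∀ (k ℓ : Fin n), (ℓ : ℕ) < (k : ℕ) → ∀ (i : Fin (N k)) (j : Fin (N ℓ)),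
      A ⟨k, i⟩ ⟨ℓ, j⟩ =
        (P k * (sssChain rh (fun j => (R j)ᵀ) ℓ ((k : ℕ) - 1))ᵀ * (Q ℓ)ᵀ) i j)

/-- The lower Hankel block `𝓗` at cut `c`: rows in blocks `{c+1, …, n-1}`, columns in blocks
`{0, …, c}`. -/
def lowerHankelBlock {n : ℕ} (N : ℕ → ℕ)
    (A : Matrix ((k : Fin n) × Fin (N k)) ((k : Fin n) × Fin (N k)) 𝔽) (c : ℕ) :
    Matrix {p : (k : Fin n) × Fin (N k) // c < (p.1 : ℕ)}
      {p : (k : Fin n) × Fin (N k) // (p.1 : ℕ) ≤ c} 𝔽 :=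
  Matrix.of fun i j => A i.1 j.1

/-- The upper Hankel block `𝓖` at cut `c`: rows in blocks `{0, …, c}`, columns in blocks
`{c+1, …, n-1}`. -/
def upperHankelBlock {n : ℕ} (N : ℕ → ℕ)
    (A : Matrix ((k : Fin n) × Fin (N k)) ((k : Fin n) × Fin (N k)) 𝔽) (c : ℕ) :
    Matrix {p : (k : Fin n) × Fin (N k) // (p.1 : ℕ) ≤ c}
      {p : (k : Fin n) × Fin (N k) // c < (p.1 : ℕ)} 𝔽 :=
  Matrix.of fun i j => A i.1 j.1

/-- The Hankel block `A_{S̄,S}` of a block matrix for a subset `S` of block indices. -/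
def blockHankel {n : ℕ} (N : ℕ → ℕ)
    (A : Matrix ((k : Fin n) × Fin (N k)) ((k : Fin n) × Fin (N k)) 𝔽) (S : Finset (Fin n)) :
    Matrix {p : (k : Fin n) × Fin (N k) // p.1 ∉ S}
      {p : (k : Fin n) × Fin (N k) // p.1 ∈ S} 𝔽 :=
  Matrix.of fun i j => A i.1 j.1

/-- `ρ_L(S)` for the line graph on `Fin n` with edges `{k, k+1}`: the number of edges with
exactly one endpoint in `S`. -/
def lineBorder (n : ℕ) (S : Finset (Fin n)) : ℕ :=
  (Finset.univ.filter fun p : Fin n × Fin n =>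
    (p.1 : ℕ) + 1 = (p.2 : ℕ) ∧ ¬((p.1 ∈ S) ↔ (p.2 ∈ S))).card

theorem sssChain_add (rg : ℕ → ℕ) (W : ∀ j, Matrix (Fin (rg j)) (Fin (rg (j + 1))) 𝔽) (k d : ℕ) :
    sssChain rg W k (k + d) = sssChainAux rg W k d := by
  have aux : ∀ (e : ℕ) (he : e = d) (h : k + e = k + d),
      h ▸ sssChainAux rg W k e = sssChainAux rg W k d := by
    rintro e rfl h
    rfl
  rw [sssChain, dif_pos (Nat.le_add_right k d)]
  exact aux _ (Nat.add_sub_cancel_left k d) _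

theorem sssChain_self (rg : ℕ → ℕ) (W : ∀ j, Matrix (Fin (rg j)) (Fin (rg (j + 1))) 𝔽) (k : ℕ) :
    sssChain rg W k k = 1 :=
  sssChain_add rg W k 0

theorem sssChain_succ (rg : ℕ → ℕ) (W : ∀ j, Matrix (Fin (rg j)) (Fin (rg (j + 1))) 𝔽)
    {k c : ℕ} (h : k ≤ c) :
    sssChain rg W k (c + 1) = sssChain rg W k c * W c := by
  obtain ⟨d, rfl⟩ := Nat.exists_eq_add_of_le h
  rw [sssChain_add]
  exact sssChain_add rg W k (d + 1)

theorem sssChain_mul_sssChain (rg : ℕ → ℕ)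
    (W : ∀ j, Matrix (Fin (rg j)) (Fin (rg (j + 1))) 𝔽) {k c d : ℕ} (hkc : k ≤ c) (hcd : c ≤ d) :
    sssChain rg W k c * sssChain rg W c d = sssChain rg W k d := by
  induction d, hcd using Nat.le_induction with
  | base => rw [sssChain_self, Matrix.mul_one]
  | succ d hcd ih =>
    rw [sssChain_succ rg W hcd, ← Matrix.mul_assoc, ih, sssChain_succ rg W (hkc.trans hcd)]

/-- A family `O` of observation matrices propagated by `W` is obtained from its diagonal by
multiplication with the chains of `W`. -/
theorem mul_sssChain_eq {n : ℕ} {N rg : ℕ → ℕ}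
    (O : ∀ k c, Matrix (Fin (N k)) (Fin (rg c)) 𝔽)
    (W : ∀ j, Matrix (Fin (rg j)) (Fin (rg (j + 1))) 𝔽)
    (hO : ∀ k c, k ≤ c → c + 1 < n → O k (c + 1) = O k c * W c)
    {k c : ℕ} (hkc : k ≤ c) (hc : c < n) :
    O k k * sssChain rg W k c = O k c := by
  induction c, hkc using Nat.le_induction with
  | base => rw [sssChain_self, Matrix.mul_one]
  | succ c hkc ih =>
    rw [sssChain_succ rg W hkc, ← Matrix.mul_assoc, ih (by lia), hO k c hkc hc]

/-- The strictly upper part of the block array `a` is given by the upper SSS generators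
`U`, `W`, `V`. -/
def IsUpperRep (n : ℕ) (N : ℕ → ℕ) (a : ∀ k l, Matrix (Fin (N k)) (Fin (N l)) 𝔽) (rg : ℕ → ℕ)
    (U : ∀ k, Matrix (Fin (N k)) (Fin (rg k)) 𝔽)
    (W : ∀ j, Matrix (Fin (rg j)) (Fin (rg (j + 1))) 𝔽)
    (V : ∀ k, Matrix (Fin (N k)) (Fin (rg (k - 1))) 𝔽) : Prop :=
  ∀ k c, k ≤ c → c + 1 < n →
    a k (c + 1) = U k * sssChain rg W k c * transpose (n := Fin (rg c)) (V (c + 1))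

theorem IsUpperRep.exists_mul {n : ℕ} {N : ℕ → ℕ}
    {a b : ∀ k l, Matrix (Fin (N k)) (Fin (N l)) 𝔽} {rA rB : ℕ → ℕ}
    {UA : ∀ k, Matrix (Fin (N k)) (Fin (rA k)) 𝔽}
    {WA : ∀ j, Matrix (Fin (rA j)) (Fin (rA (j + 1))) 𝔽}
    {VA : ∀ k, Matrix (Fin (N k)) (Fin (rA (k - 1))) 𝔽}
    {UB : ∀ k, Matrix (Fin (N k)) (Fin (rB k)) 𝔽}
    {WB : ∀ j, Matrix (Fin (rB j)) (Fin (rB (j + 1))) 𝔽}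
    {VB : ∀ k, Matrix (Fin (N k)) (Fin (rB (k - 1))) 𝔽}
    (hA : IsUpperRep n N a rA UA WA VA) (hB : IsUpperRep n N b rB UB WB VB) :
    ∃ (U : ∀ k, Matrix (Fin (N k)) (Fin (rA k + rB k)) 𝔽)
      (W : ∀ j, Matrix (Fin (rA j + rB j)) (Fin (rA (j + 1) + rB (j + 1))) 𝔽)
      (V : ∀ k, Matrix (Fin (N k)) (Fin (rA (k - 1) + rB (k - 1))) 𝔽),
      IsUpperRep n N (fun k l => ∑ m ∈ Finset.range n, a k m * b m l)
        (fun c => rA c + rB c) U W V := by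
  let O : ∀ k c, Matrix (Fin (N k)) (Fin (rA c + rB c)) 𝔽 := fun k c =>
    (fromCols (UA k * sssChain rA WA k c)
      (∑ m ∈ Finset.range (c + 1), a k m * (UB m * sssChain rB WB m c))).submatrix
        id finSumFinEquiv.symm
  let W : ∀ j, Matrix (Fin (rA j + rB j)) (Fin (rA (j + 1) + rB (j + 1))) 𝔽 := fun j =>
    (fromBlocks (WA j) ((VA (j + 1))ᵀ * UB (j + 1)) 0 (WB j)).submatrix
      finSumFinEquiv.symm finSumFinEquiv.symm
  let V : ∀ k, Matrix (Fin (N k)) (Fin (rA (k - 1) + rB (k - 1))) 𝔽 := fun k =>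
    (fromCols (∑ m ∈ Finset.Ico k n, sssChain rA WA (k - 1) (m - 1) * (VA m)ᵀ * b m k)ᵀ
      (VB k)).submatrix id finSumFinEquiv.symm
  have hO : ∀ k c, k ≤ c → c + 1 < n → O k (c + 1) = O k c * W c := by
    intro k c hkc hc
    simp only [O, W]
    rw [submatrix_mul_equiv, fromCols_mul_fromBlocks]
    congr 2
    · rw [Matrix.mul_zero, add_zero, sssChain_succ rA WA hkc, Matrix.mul_assoc]
    · rw [Finset.sum_range_succ, sssChain_self, Matrix.mul_one, hA k c hkc hc, Matrix.sum_mul]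
      refine (add_comm _ _).trans (congrArg₂ (· + ·) ?_ ?_)
      · simp only [Matrix.mul_assoc]
      · refine Finset.sum_congr rfl fun m hm => ?_
        rw [sssChain_succ rB WB (by simpa [Nat.lt_succ_iff] using hm)]
        simp only [Matrix.mul_assoc]
  refine ⟨fun k => O k k, W, V, fun k c hkc hc => ?_⟩
  have key := mul_sssChain_eq (rg := fun c => rA c + rB c) O W hO hkc (by lia : c < n)
  refine Eq.trans ?_ (congrArg (· * transpose (n := Fin (rA c + rB c)) (V (c + 1))) key).symm
  have hV : transpose (n := Fin (rA c + rB c)) (V (c + 1)) = (fromRows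
      (∑ m ∈ Finset.Ico (c + 1) n, sssChain rA WA c (m - 1) * (VA m)ᵀ * b m (c + 1))
      (VB (c + 1))ᵀ).submatrix finSumFinEquiv.symm id := by
    simp only [V]
    rw [transpose_submatrix, transpose_fromCols, transpose_transpose]
    rfl
  simp only [hV, O]
  rw [submatrix_mul_equiv, fromCols_mul_fromRows, submatrix_id_id, Matrix.mul_sum,
    ← Finset.sum_range_add_sum_Ico _ hc.le, Matrix.sum_mul]
  refine (add_comm _ _).trans (congrArg₂ (· + ·) ?_ ?_)
  · refine Finset.sum_congr rfl fun m hm => ?_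
    obtain ⟨hcm, hmn⟩ := Finset.mem_Ico.mp hm
    obtain ⟨m, rfl⟩ := Nat.exists_eq_add_of_le' (Nat.one_le_of_lt hcm)
    rw [hA k m (by lia) hmn, ← sssChain_mul_sssChain rA WA hkc (by lia)]
    simp only [Matrix.mul_assoc]
    rfl
  · refine Finset.sum_congr rfl fun m hm => ?_
    rw [hB m c (by simpa [Nat.lt_succ_iff] using hm) hc]
    simp only [Matrix.mul_assoc]

/-- The blocks of a block matrix, extended by zero to all natural block indices. -/
def natBlock {n : ℕ} (N : ℕ → ℕ)
    (A : Matrix ((k : Fin n) × Fin (N k)) ((k : Fin n) × Fin (N k)) 𝔽) (k l : ℕ) :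
    Matrix (Fin (N k)) (Fin (N l)) 𝔽 :=
  if hk : k < n then if hl : l < n then of fun i j => A ⟨⟨k, hk⟩, i⟩ ⟨⟨l, hl⟩, j⟩ else 0 else 0

theorem natBlock_apply {n : ℕ} (N : ℕ → ℕ)
    (A : Matrix ((k : Fin n) × Fin (N k)) ((k : Fin n) × Fin (N k)) 𝔽) (k l : Fin n)
    (i : Fin (N k)) (j : Fin (N l)) :
    natBlock N A k l i j = A ⟨k, i⟩ ⟨l, j⟩ := by
  simp [natBlock]

theorem mul_apply_eq_sum_natBlock {n : ℕ} (N : ℕ → ℕ)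
    (A B : Matrix ((k : Fin n) × Fin (N k)) ((k : Fin n) × Fin (N k)) 𝔽) (k l : Fin n)
    (i : Fin (N k)) (j : Fin (N l)) :
    (A * B) ⟨k, i⟩ ⟨l, j⟩ = (∑ m ∈ Finset.range n, natBlock N A k m * natBlock N B m l) i j := by
  rw [Matrix.mul_apply, Fintype.sum_sigma, Matrix.sum_apply, Finset.sum_range]
  simp only [Matrix.mul_apply, natBlock_apply]

theorem isUpperRep_natBlock {n : ℕ} {N : ℕ → ℕ}
    {A : Matrix ((k : Fin n) × Fin (N k)) ((k : Fin n) × Fin (N k)) 𝔽} {rg : ℕ → ℕ}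
    {U : ∀ k, Matrix (Fin (N k)) (Fin (rg k)) 𝔽}
    {W : ∀ j, Matrix (Fin (rg j)) (Fin (rg (j + 1))) 𝔽}
    {V : ∀ k, Matrix (Fin (N k)) (Fin (rg (k - 1))) 𝔽}
    (h : ∀ k l : Fin n, (k : ℕ) < l → ∀ (i : Fin (N k)) (j : Fin (N l)),
      A ⟨k, i⟩ ⟨l, j⟩ = (U k * sssChain rg W k ((l : ℕ) - 1) * (V l)ᵀ) i j) :
    IsUpperRep n N (natBlock N A) rg U W V := by
  intro k c hkc hc
  ext i j
  exact (natBlock_apply N A ⟨k, by lia⟩ ⟨c + 1, hc⟩ i j).trans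
    (h ⟨k, by lia⟩ ⟨c + 1, hc⟩ (Nat.lt_succ_of_le hkc) i j)

/-- The strictly upper part of a product of block matrices has upper SSS generators whose
dimensions are the sums of those of the factors. -/
theorem exists_upper_generators_mul {n : ℕ} {N : ℕ → ℕ}
    {A B : Matrix ((k : Fin n) × Fin (N k)) ((k : Fin n) × Fin (N k)) 𝔽} {rA rB : ℕ → ℕ}
    {UA : ∀ k, Matrix (Fin (N k)) (Fin (rA k)) 𝔽}
    {WA : ∀ j, Matrix (Fin (rA j)) (Fin (rA (j + 1))) 𝔽}
    {VA : ∀ k, Matrix (Fin (N k)) (Fin (rA (k - 1))) 𝔽}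
    {UB : ∀ k, Matrix (Fin (N k)) (Fin (rB k)) 𝔽}
    {WB : ∀ j, Matrix (Fin (rB j)) (Fin (rB (j + 1))) 𝔽}
    {VB : ∀ k, Matrix (Fin (N k)) (Fin (rB (k - 1))) 𝔽}
    (hA : ∀ k l : Fin n, (k : ℕ) < l → ∀ (i : Fin (N k)) (j : Fin (N l)),
      A ⟨k, i⟩ ⟨l, j⟩ = (UA k * sssChain rA WA k ((l : ℕ) - 1) * (VA l)ᵀ) i j)
    (hB : ∀ k l : Fin n, (k : ℕ) < l → ∀ (i : Fin (N k)) (j : Fin (N l)),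
      B ⟨k, i⟩ ⟨l, j⟩ = (UB k * sssChain rB WB k ((l : ℕ) - 1) * (VB l)ᵀ) i j) :
    ∃ (U : ∀ k, Matrix (Fin (N k)) (Fin (rA k + rB k)) 𝔽)
      (W : ∀ j, Matrix (Fin (rA j + rB j)) (Fin (rA (j + 1) + rB (j + 1))) 𝔽)
      (V : ∀ k, Matrix (Fin (N k)) (Fin (rA (k - 1) + rB (k - 1))) 𝔽),
      ∀ k l : Fin n, (k : ℕ) < l → ∀ (i : Fin (N k)) (j : Fin (N l)),
        (A * B) ⟨k, i⟩ ⟨l, j⟩ =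
          (U k * sssChain (fun c => rA c + rB c) W k ((l : ℕ) - 1) * (V l)ᵀ) i j := by
  obtain ⟨U, W, V, h⟩ := (isUpperRep_natBlock hA).exists_mul (isUpperRep_natBlock hB)
  refine ⟨U, W, V, fun k ⟨l, hl⟩ hkl i j => ?_⟩
  obtain ⟨c, rfl⟩ := Nat.exists_eq_add_of_le' (Nat.one_le_of_lt hkl)
  rw [mul_apply_eq_sum_natBlock]
  exact congrFun (congrFun (h k c (Nat.le_of_lt_succ hkl) hl) i) j

/-- If `A` and `B` admit SSS representations with dimensions `(rhA, rgA)` and `(rhB, rgB)`, then `A * B` admits an SSS representation whose dimensions satisfy `rhC c ≤ rhA c + rhB c` and `rgC c ≤ rgA c + rgB c` at every cut. -/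
theorem sss_mul {n : ℕ} (N : ℕ → ℕ)
    (A B : Matrix ((k : Fin n) × Fin (N k)) ((k : Fin n) × Fin (N k)) 𝔽)
    (rgA rhA rgB rhB : ℕ → ℕ)
    (UA : ∀ k, Matrix (Fin (N k)) (Fin (rgA k)) 𝔽)
    (WA : ∀ j, Matrix (Fin (rgA j)) (Fin (rgA (j + 1))) 𝔽)
    (VA : ∀ k, Matrix (Fin (N k)) (Fin (rgA (k - 1))) 𝔽)
    (DA : ∀ k, Matrix (Fin (N k)) (Fin (N k)) 𝔽)
    (PA : ∀ k, Matrix (Fin (N k)) (Fin (rhA (k - 1))) 𝔽)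
    (RA : ∀ j, Matrix (Fin (rhA (j + 1))) (Fin (rhA j)) 𝔽)
    (QA : ∀ k, Matrix (Fin (N k)) (Fin (rhA k)) 𝔽)
    (hA : IsSSSRep N A rgA rhA UA WA VA DA PA RA QA)
    (UB : ∀ k, Matrix (Fin (N k)) (Fin (rgB k)) 𝔽)
    (WB : ∀ j, Matrix (Fin (rgB j)) (Fin (rgB (j + 1))) 𝔽)
    (VB : ∀ k, Matrix (Fin (N k)) (Fin (rgB (k - 1))) 𝔽)
    (DB : ∀ k, Matrix (Fin (N k)) (Fin (N k)) 𝔽)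
    (PB : ∀ k, Matrix (Fin (N k)) (Fin (rhB (k - 1))) 𝔽)
    (RB : ∀ j, Matrix (Fin (rhB (j + 1))) (Fin (rhB j)) 𝔽)
    (QB : ∀ k, Matrix (Fin (N k)) (Fin (rhB k)) 𝔽)
    (hB : IsSSSRep N B rgB rhB UB WB VB DB PB RB QB) :
    ∃ (rgC rhC : ℕ → ℕ)
      (UC : ∀ k, Matrix (Fin (N k)) (Fin (rgC k)) 𝔽)
      (WC : ∀ j, Matrix (Fin (rgC j)) (Fin (rgC (j + 1))) 𝔽)
      (VC : ∀ k, Matrix (Fin (N k)) (Fin (rgC (k - 1))) 𝔽)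
      (DC : ∀ k, Matrix (Fin (N k)) (Fin (N k)) 𝔽)
      (PC : ∀ k, Matrix (Fin (N k)) (Fin (rhC (k - 1))) 𝔽)
      (RC : ∀ j, Matrix (Fin (rhC (j + 1))) (Fin (rhC j)) 𝔽)
      (QC : ∀ k, Matrix (Fin (N k)) (Fin (rhC k)) 𝔽),
      IsSSSRep N (A * B) rgC rhC UC WC VC DC PC RC QC ∧
        ∀ c : ℕ, c < n - 1 →
          rhC c ≤ rhA c + rhB c ∧ rgC c ≤ rgA c + rgB c := by
  obtain ⟨-, hAu, hAl⟩ := hA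
  obtain ⟨-, hBu, hBl⟩ := hB
  have transpose_lower : ∀ (M : Matrix ((k : Fin n) × Fin (N k)) ((k : Fin n) × Fin (N k)) 𝔽)
      (r : ℕ → ℕ) (P : ∀ k, Matrix (Fin (N k)) (Fin (r (k - 1))) 𝔽)
      (S : ∀ j, Matrix (Fin (r j)) (Fin (r (j + 1))) 𝔽)
      (Q : ∀ k, Matrix (Fin (N k)) (Fin (r k)) 𝔽) (k l : Fin n) (i : Fin (N k)) (j : Fin (N l)),
      (M ⟨l, j⟩ ⟨k, i⟩ = (P l * (sssChain r S k ((l : ℕ) - 1))ᵀ * (Q k)ᵀ) j i) ↔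
      Mᵀ ⟨k, i⟩ ⟨l, j⟩ = (Q k * sssChain r S k ((l : ℕ) - 1) * (P l)ᵀ) i j := by
    intro M r P S Q k l i j
    rw [← transpose_apply (Q k * _ * _) j i, transpose_mul, transpose_mul, transpose_transpose,
      Matrix.mul_assoc, transpose_apply M]
  obtain ⟨U, W, V, hu⟩ := exists_upper_generators_mul hAu hBu
  obtain ⟨Q, S, P, hl⟩ := exists_upper_generators_mul
    (fun k l hkl i j => (transpose_lower B _ _ _ _ k l i j).mp (hBl l k hkl j i))
    (fun k l hkl i j => (transpose_lower A _ _ _ _ k l i j).mp (hAl l k hkl j i))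
  refine ⟨fun c => rgA c + rgB c, fun c => rhB c + rhA c, U, W, V,
    fun k => natBlock N (A * B) k k, P, fun j => (S j)ᵀ, Q,
    ⟨fun k i j => (natBlock_apply N (A * B) k k i j).symm, hu, fun k l hlk i j => ?_⟩,
    fun c _ => ⟨(add_comm _ _).le, le_rfl⟩⟩
  rw [← transpose_mul] at hl
  exact (transpose_lower (A * B) (fun c => rhB c + rhA c) P S Q l k j i).mpr (hl l k hlk j i)
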